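/- arXiv:0902.1250 — 6 statements merged into one kernel-verified Lean document; each statement's English description precedes it below -/
import Mathlib

section
/- Fix n ≥ 1. Let F be a finite family where each member f ∈ F consists of a finite set S_f of integer vectors u ∈ ℤⁿ (encoded as functions Fin n → ℤ) together with coefficients c_f : S_f → ℂ. Define τ = { z ∈ ℂⁿ : for every f ∈ F and every t ∈ ℂ, ∑_{u ∈ S_f} c_f(u)·exp( t·∑_{i} u_i z_i ) = 0 }. Then there exist finitely many ℂ-linear subspaces L₁, …, L_m of ℂⁿ, each of which is defined over ℚ in the sense that L_j = { z ∈ ℂⁿ : ∑_i w_i z_i = 0 for all w ∈ Q_j } for some finite set Q_j of integer vectors, such that τ = L₁ ∪ ⋯ ∪ L_m. -/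
open scoped Classical

/-- The exponential character `t ↦ exp (t * a)` of the additive group of `ℂ`. -/
noncomputable def expCharacter (a : ℂ) : Multiplicative ℂ →* ℂ where
  toFun t := Complex.exp (t.toAdd * a)
  map_one' := by simp
  map_mul' s t := by simp [add_mul, Complex.exp_add]

lemma expCharacter_injective : Function.Injective expCharacter := by
  intro a b h
  by_contra hab
  have hsub : a - b ≠ 0 := sub_ne_zero.mpr hab
  have h1 : Complex.exp ((a - b)⁻¹ * a) = Complex.exp ((a - b)⁻¹ * b) :=
    DFunLike.congr_fun h (Multiplicative.ofAdd (a - b)⁻¹)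
  have h2 : Complex.exp 1 = 1 := by
    calc Complex.exp 1 = Complex.exp ((a - b)⁻¹ * a - (a - b)⁻¹ * b) := by
          rw [← mul_sub, inv_mul_cancel₀ hsub]
      _ = 1 := by rw [Complex.exp_sub, h1, div_self (Complex.exp_ne_zero _)]
  have h3 : Real.exp 1 = 1 := by
    apply Complex.ofReal_injective
    simpa using h2
  exact one_ne_zero ((Real.exp_eq_one_iff 1).mp h3)

/-- An exponential polynomial with constant coefficients and distinct frequencies vanishes
identically only if all its coefficients do. -/
lemma eq_zero_of_sum_mul_exp_eq_zero (A : Finset ℂ) (d : ℂ → ℂ)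
    (h : ∀ t : ℂ, ∑ a ∈ A, d a * Complex.exp (t * a) = 0) : ∀ a ∈ A, d a = 0 := by
  have hli : LinearIndependent ℂ (fun a : ℂ => (expCharacter a : Multiplicative ℂ → ℂ)) :=
    (linearIndependent_monoidHom (Multiplicative ℂ) ℂ).comp _ expCharacter_injective
  refine linearIndependent_iff'.mp hli A d ?_
  ext t
  simpa [Finset.sum_apply, expCharacter] using h t.toAdd

/-- If an exponential sum with frequencies `p u` vanishes identically, then so does the sum with
frequencies `q u`, provided `q` identifies all indices that `p` identifies. -/
lemma sum_mul_exp_eq_zero_of_factors {α : Type*} (S : Finset α) (c p q : α → ℂ)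
    (h : ∀ t : ℂ, ∑ u ∈ S, c u * Complex.exp (t * p u) = 0)
    (hpq : ∀ u ∈ S, ∀ v ∈ S, p u = p v → q u = q v) (t : ℂ) :
    ∑ u ∈ S, c u * Complex.exp (t * q u) = 0 := by
  have hfiber : ∀ a ∈ S.image p, ∑ u ∈ S with p u = a, c u = 0 := by
    refine eq_zero_of_sum_mul_exp_eq_zero (S.image p) (fun a => ∑ u ∈ S with p u = a, c u) ?_
    intro t
    rw [← h t, ← Finset.sum_fiberwise_of_maps_to (fun u hu => Finset.mem_image_of_mem p hu)]
    refine Finset.sum_congr rfl fun a _ => ?_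
    rw [Finset.sum_mul]
    exact Finset.sum_congr rfl fun u hu => by rw [(Finset.mem_filter.mp hu).2]
  rw [← Finset.sum_fiberwise_of_maps_to (fun u hu => Finset.mem_image_of_mem p hu)]
  refine Finset.sum_eq_zero fun a ha => ?_
  obtain ⟨v, hv, rfl⟩ := Finset.mem_image.mp ha
  calc ∑ u ∈ S with p u = p v, c u * Complex.exp (t * q u)
      = ∑ u ∈ S with p u = p v, c u * Complex.exp (t * q v) :=
        Finset.sum_congr rfl fun u hu => by
          rw [hpq u (Finset.mem_filter.mp hu).1 v hv (Finset.mem_filter.mp hu).2]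
    _ = 0 := by rw [← Finset.sum_mul, hfiber _ ha, zero_mul]

/-- The subspace of `ℂⁿ` cut out by the linear equations with coefficient vectors in `Q`. -/
def integralSubspace {n : ℕ} (Q : Finset (Fin n → ℤ)) : Submodule ℂ (Fin n → ℂ) where
  carrier := {z | ∀ w ∈ Q, ∑ i, (w i : ℂ) * z i = 0}
  zero_mem' := by simp
  add_mem' hx hy w hw := by simp [mul_add, Finset.sum_add_distrib, hx w hw, hy w hw]
  smul_mem' a x hx w hw := by
    simp [mul_left_comm _ a, ← Finset.mul_sum, hx w hw]

/-- The exponential tangent cone at `1` of the common zero locus in `(ℂ*)ⁿ` of a finite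
family of Laurent polynomials `f = ∑_{u ∈ S_f} c_f(u) t₁^{u₁} ⋯ t_n^{u_n}`, i.e. the set
`τ = { z ∈ ℂⁿ : ∀ f, ∀ t ∈ ℂ, ∑_{u ∈ S_f} c_f(u) e^{⟨u,z⟩ t} = 0 }`, is a finite union of
linear subspaces of `ℂⁿ`, each defined over `ℚ` (in fact cut out by finitely many linear
equations with integer coefficients). -/
theorem exp_tangent_cone_is_finite_union_of_rational_subspaces
    (n : ℕ) (hn : 1 ≤ n) {ι : Type*} [Fintype ι]
    (S : ι → Finset (Fin n → ℤ)) (c : ι → (Fin n → ℤ) → ℂ) :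
    ∃ (m : ℕ) (L : Fin m → Submodule ℂ (Fin n → ℂ)),
      (∀ j : Fin m, ∃ Q : Finset (Fin n → ℤ),
        (L j : Set (Fin n → ℂ)) =
          {z : Fin n → ℂ | ∀ w ∈ Q, ∑ i, (w i : ℂ) * z i = 0}) ∧
      {z : Fin n → ℂ | ∀ (f : ι) (t : ℂ),
          ∑ u ∈ S f, c f u * Complex.exp (t * ∑ i, (u i : ℂ) * z i) = 0}
        = ⋃ j : Fin m, (L j : Set (Fin n → ℂ)) := by
  let τ : Set (Fin n → ℂ) := {z | ∀ (f : ι) (t : ℂ),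
    ∑ u ∈ S f, c f u * Complex.exp (t * ∑ i, (u i : ℂ) * z i) = 0}
  let D : Finset (Fin n → ℤ) :=
    Finset.univ.biUnion fun f => (S f ×ˢ S f).image fun x => x.1 - x.2
  let G : Finset (Finset (Fin n → ℤ)) :=
    D.powerset.filter fun Q => (integralSubspace Q : Set (Fin n → ℂ)) ⊆ τ
  refine ⟨G.card, fun j => integralSubspace (G.equivFin.symm j : Finset (Fin n → ℤ)),
    fun j => ⟨_, rfl⟩, ?_⟩
  change τ = _
  refine Set.Subset.antisymm ?_
    (Set.iUnion_subset fun j => (Finset.mem_filter.mp (G.equivFin.symm j).2).2)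
  intro z hz
  let Q := D.filter fun w => ∑ i, (w i : ℂ) * z i = 0
  have hQ : Q ∈ G := by
    refine Finset.mem_filter.mpr ⟨Finset.mem_powerset.mpr (Finset.filter_subset _ _), ?_⟩
    intro z' hz' f
    refine sum_mul_exp_eq_zero_of_factors (S f) (c f) _ _ (hz f) fun u hu v hv huv => ?_
    have hD : u - v ∈ D := Finset.mem_biUnion.mpr ⟨f, Finset.mem_univ f,
      Finset.mem_image.mpr ⟨(u, v), Finset.mem_product.mpr ⟨hu, hv⟩, rfl⟩⟩
    have key := hz' (u - v) (Finset.mem_filter.mpr ⟨hD, by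
      simpa [sub_mul, Finset.sum_sub_distrib, sub_eq_zero] using huv⟩)
    simpa [sub_mul, Finset.sum_sub_distrib, sub_eq_zero] using key
  refine Set.mem_iUnion.mpr ⟨G.equivFin ⟨Q, hQ⟩, ?_⟩
  beta_reduce
  rw [Equiv.symm_apply_apply]
  exact fun w hw => (Finset.mem_filter.mp hw).2
end

section
/- Let A be a commutative ring that is also a ℚ-algebra, and let m ⊆ A be a nilpotent ideal (m^N = 0 for some N). Let r ≥ 1, let s be an r×r matrix over A all of whose entries lie in m (so that s is a nilpotent matrix and its exponential exp(s) = ∑_{j≥0} s^j/j! is a well-defined finite sum), and let v ∈ A^r. Then the following are equivalent: (1) exp(s)^k · v = v for some positive integer k; (2) exp(s) · v = v; (3) s · v = 0. -/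
theorem Matrix.pow_apply_mem_pow {A n : Type*} [CommRing A] [Fintype n] [DecidableEq n]
    {m : Ideal A} {s : Matrix n n A} (hs : ∀ i j, s i j ∈ m) (k : ℕ) (i j : n) :
    (s ^ k) i j ∈ m ^ k := by
  induction k generalizing i j with
  | zero => simp
  | succ k ih =>
    rw [pow_succ, pow_succ, Matrix.mul_apply]
    exact Ideal.sum_mem _ fun l _ => Ideal.mul_mem_mul (ih i l) (hs l j)

theorem IsNilpotent.exp_nsmul {R : Type*} [Ring R] [Algebra ℚ R] {a : R} (ha : IsNilpotent a)
    (k : ℕ) : IsNilpotent.exp (k • a) = IsNilpotent.exp a ^ k := by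
  induction k with
  | zero => simp
  | succ k ih =>
    rw [succ_nsmul, _root_.pow_succ, ← ih]
    exact exp_add_of_commute ((Commute.refl a).smul_left k) (ha.smul k) ha

theorem IsNilpotent.exists_isUnit_exp_sub_one_eq_mul {R : Type*} [Ring R] [Algebra ℚ R] {a : R}
    (ha : IsNilpotent a) : ∃ u : R, IsUnit u ∧ IsNilpotent.exp a - 1 = u * a := by
  obtain ⟨n, hn⟩ := ha
  let t : R := ∑ j ∈ Finset.range n, ((j + 2).factorial : ℚ)⁻¹ • a ^ j
  have hcomm : Commute t a :=
    Commute.sum_left _ _ _ fun j _ => ((Commute.refl a).pow_left j).smul_left _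
  refine ⟨t * a + 1, (hcomm.isNilpotent_mul_left ⟨n, hn⟩).isUnit_add_one, ?_⟩
  rw [exp_eq_sum (pow_eq_zero_of_le (Nat.le_add_right n 2) hn), Finset.sum_range_succ',
    Finset.sum_range_succ']
  simp [t, add_mul, Finset.sum_mul, _root_.pow_succ, mul_assoc]

theorem Matrix.exp_mulVec_eq_self_iff {A n : Type*} [CommRing A] [Algebra ℚ A] [Fintype n]
    [DecidableEq n] {s : Matrix n n A} (hs : IsNilpotent s) (v : n → A) :
    (IsNilpotent.exp s).mulVec v = v ↔ s.mulVec v = 0 := by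
  obtain ⟨u, hu, h⟩ := hs.exists_isUnit_exp_sub_one_eq_mul
  rw [← sub_eq_zero]
  nth_rewrite 2 [← Matrix.one_mulVec v]
  rw [← Matrix.sub_mulVec, h, ← Matrix.mulVec_mulVec]
  exact (Matrix.mulVec_injective_of_isUnit hu).eq_iff' (Matrix.mulVec_zero u)


/-- Let `A` be a commutative `ℚ`-algebra and `m ⊆ A` a nilpotent ideal (`m ^ N = 0`).
Let `s` be an `r × r` matrix with entries in `m` (so `s` is nilpotent, and its
exponential is the finite sum `E = ∑_{j < N} s^j / j!`), and let `v ∈ A^r`.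
Then the following are equivalent: `E^k v = v` for some positive integer `k`;
`E v = v`; and `s v = 0`. -/
theorem exp_fixed_vector_iff_annihilated
    (A : Type*) [CommRing A] [Algebra ℚ A] (m : Ideal A) (N : ℕ) (hm : m ^ N = ⊥)
    (r : ℕ) (hr : 1 ≤ r) (s : Matrix (Fin r) (Fin r) A) (hs : ∀ i j, s i j ∈ m)
    (v : Fin r → A) (E : Matrix (Fin r) (Fin r) A)
    (hE : E = ∑ j ∈ Finset.range N, ((j.factorial : ℚ)⁻¹ • s ^ j)) :
    ((∃ k : ℕ, 0 < k ∧ (E ^ k).mulVec v = v) ↔ E.mulVec v = v)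
      ∧ (E.mulVec v = v ↔ s.mulVec v = 0) := by
  have hsN : s ^ N = 0 := by
    ext i j
    simpa [hm] using Matrix.pow_apply_mem_pow hs N i j
  have hnil : IsNilpotent s := ⟨N, hsN⟩
  rw [← IsNilpotent.exp_eq_sum hsN] at hE
  subst hE
  refine ⟨⟨?_, fun h => ⟨1, one_pos, by rwa [pow_one]⟩⟩, Matrix.exp_mulVec_eq_self_iff hnil v⟩
  rintro ⟨k, hk, h⟩
  rw [← hnil.exp_nsmul, Matrix.exp_mulVec_eq_self_iff (hnil.smul k), Matrix.smul_mulVec,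
    ← Nat.cast_smul_eq_nsmul ℚ] at h
  rw [Matrix.exp_mulVec_eq_self_iff hnil]
  exact (smul_eq_zero_iff_right (Nat.cast_ne_zero.mpr hk.ne')).mp h
end

section
/- Let H¹ and H² be complex vector spaces, and let μ : H¹ × H¹ → H² be a ℂ-bilinear alternating map (μ(x,x) = 0 for all x). Let V ⊆ H¹ be a linear subspace of finite dimension k, and set i = dim_ℂ span{ μ(x,y) : x, y ∈ V }. Assume i < k − 1. Then: (a) for every x ∈ V, the subspace { y ∈ V : μ(x,y) = 0 } of V has dimension at least k − i; and (b) for every nonzero x ∈ V there exists y ∈ H¹ with μ(x,y) = 0 and y ∉ ℂ·x; more precisely, the quotient of { y ∈ H¹ : μ(x,y) = 0 } by the line ℂ·x has dimension at least k − i − 1 ≥ 1. -/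
/-- The span of the values of a bilinear map on a finite-dimensional subspace is
finite-dimensional. -/
theorem finiteDimensional_span_bilinear_values
    {K E F : Type*} [Field K] [AddCommGroup E] [Module K E] [AddCommGroup F] [Module K F]
    (μ : E →ₗ[K] E →ₗ[K] F) (V : Submodule K E) [FiniteDimensional K V] :
    FiniteDimensional K (Submodule.span K {w : F | ∃ x ∈ V, ∃ y ∈ V, μ x y = w}) := by
  have hV : V.FG := Submodule.fg_iff_finiteDimensional V |>.2 inferInstance
  have h := hV.map₂ μ hV
  rw [Submodule.map₂_eq_span_image2] at h
  exact Submodule.fg_iff_finiteDimensional _ |>.1 h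

/-- If a linear map sends a finite-dimensional subspace `V` into a finite-dimensional subspace
`S`, then `dim V ≤ dim (V ⊓ ker f) + dim S`. -/
theorem finrank_le_finrank_inf_ker_add
    {K E F : Type*} [Field K] [AddCommGroup E] [Module K E] [AddCommGroup F] [Module K F]
    (f : E →ₗ[K] F) (V : Submodule K E) [FiniteDimensional K V]
    (S : Submodule K F) [FiniteDimensional K S] (h : V ≤ S.comap f) :
    Module.finrank K V ≤
      Module.finrank K (V ⊓ LinearMap.ker f : Submodule K E) + Module.finrank K S := by
  have hrange : LinearMap.range (f.domRestrict V) ≤ S := by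
    rintro _ ⟨v, rfl⟩
    exact h v.2
  have hker : Module.finrank K (LinearMap.ker (f.domRestrict V)) =
      Module.finrank K (V ⊓ LinearMap.ker f : Submodule K E) := by
    rw [LinearMap.ker_domRestrict, ← Submodule.map_comap_subtype]
    exact (Submodule.finrank_map_subtype_eq V _).symm
  have hdim := (f.domRestrict V).finrank_range_add_finrank_ker
  have hle := Submodule.finrank_mono hrange
  omega


/-- Lemma 6.4: let `μ : H¹ × H¹ → H²` be a `ℂ`-bilinear alternating map, `V ⊆ H¹` a
linear subspace of dimension `k`, and `i = dim μ(V ∧ V)`. If `i < k - 1` then: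
(a) for every `x ∈ V` the subspace `{y ∈ V : μ(x,y) = 0}` has dimension at least `k - i`;
(b) for every nonzero `x ∈ V` there is `y ∈ H¹` with `μ(x,y) = 0` and `y ∉ ℂ·x`; more
precisely, the quotient of `ker μ(x,·)` by the line `ℂ·x` has dimension at least
`k - i - 1 ≥ 1`. -/
theorem resonance_of_small_image
    {H1 H2 : Type*} [AddCommGroup H1] [Module ℂ H1] [AddCommGroup H2] [Module ℂ H2]
    (μ : H1 →ₗ[ℂ] H1 →ₗ[ℂ] H2) (halt : ∀ x : H1, μ x x = 0)
    (V : Submodule ℂ H1) [FiniteDimensional ℂ V] (k i : ℕ)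
    (hk : Module.finrank ℂ V = k)
    (hi : Module.finrank ℂ
      (Submodule.span ℂ {w : H2 | ∃ x ∈ V, ∃ y ∈ V, μ x y = w}) = i)
    (hik : i + 1 < k) :
    (∀ x ∈ V, k - i ≤ Module.finrank ℂ (V ⊓ LinearMap.ker (μ x) : Submodule ℂ H1)) ∧
    (∀ x ∈ V, x ≠ 0 →
      (∃ y : H1, μ x y = 0 ∧ y ∉ Submodule.span ℂ ({x} : Set H1)) ∧
      ((k - i - 1 : ℕ) : Cardinal) ≤ Module.rank ℂ
        (LinearMap.ker (μ x) ⧸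
          Submodule.comap (LinearMap.ker (μ x)).subtype (Submodule.span ℂ ({x} : Set H1))) ∧
      1 ≤ k - i - 1) := by
  have := finiteDimensional_span_bilinear_values μ V
  have ha : ∀ x ∈ V,
      k - i ≤ Module.finrank ℂ (V ⊓ LinearMap.ker (μ x) : Submodule ℂ H1) := by
    intro x hx
    have h := finrank_le_finrank_inf_ker_add (μ x) V
      (Submodule.span ℂ {w : H2 | ∃ x ∈ V, ∃ y ∈ V, μ x y = w})
      fun y hy => Submodule.subset_span ⟨x, hx, y, hy, rfl⟩
    omega
  refine ⟨ha, fun x hx hx0 => ⟨?_, ?_, by omega⟩⟩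
  · by_contra! h
    have hle : V ⊓ LinearMap.ker (μ x) ≤ Submodule.span ℂ ({x} : Set H1) :=
      fun y hy => h y hy.2
    have h1 := Submodule.finrank_mono hle
    rw [finrank_span_singleton hx0] at h1
    have h2 := ha x hx
    omega
  · have hK : ((k - i : ℕ) : Cardinal) ≤ Module.rank ℂ (LinearMap.ker (μ x)) := by
      have hW : ((k - i : ℕ) : Cardinal) ≤
          Module.rank ℂ (V ⊓ LinearMap.ker (μ x) : Submodule ℂ H1) := by
        rw [← Module.finrank_eq_rank]
        exact_mod_cast ha x hx
      exact hW.trans (Submodule.rank_mono inf_le_right)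
    have hspan : Submodule.span ℂ ({x} : Set H1) ≤ LinearMap.ker (μ x) := by
      simpa using halt x
    have hL : Module.rank ℂ (Submodule.comap (LinearMap.ker (μ x)).subtype
        (Submodule.span ℂ ({x} : Set H1))) ≤ 1 := by
      rw [(Submodule.comapSubtypeEquivOfLe hspan).rank_eq]
      exact (rank_span_le _).trans (by simp)
    rw [← Submodule.rank_quotient_add_rank (Submodule.comap (LinearMap.ker (μ x)).subtype
        (Submodule.span ℂ ({x} : Set H1)))] at hK
    have h := hK.trans (add_le_add_right hL _)
    rw [show k - i = k - i - 1 + 1 by omega, Nat.cast_add, Nat.cast_one] at h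
    exact Cardinal.add_one_le_add_one_iff.1 h
end

section
/- Let U¹, V¹ be finite-dimensional complex vector spaces and U², V² complex vector spaces. Let μ_U : U¹ × U¹ → U² and μ_V : V¹ × V¹ → V² be ℂ-bilinear alternating maps. Define Z² = U² × V² × (U¹ ⊗_ℂ V¹) and the bilinear alternating map μ = μ_U × μ_V on Z¹ = U¹ × V¹ by μ((a,b),(x,y)) = ( μ_U(a,x), μ_V(b,y), a ⊗ y − x ⊗ b ). Then for every nonzero (a,b) ∈ U¹ × V¹ the following are equivalent: (i) there exists (x,y) ∈ U¹ × V¹ with μ((a,b),(x,y)) = 0 and (x,y) ∉ ℂ·(a,b); (ii) either b = 0 and there exists x ∈ U¹ with μ_U(a,x) = 0 and x ∉ ℂ·a, or a = 0 and there exists y ∈ V¹ with μ_V(b,y) = 0 and y ∉ ℂ·b. -/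
open scoped TensorProduct

theorem apply_smul_eq_of_tmul_eq_tmul {R U V : Type*} [CommSemiring R]
    [AddCommMonoid U] [Module R U] [AddCommMonoid V] [Module R V]
    (f : Module.Dual R U) {a x : U} {y b : V} (h : a ⊗ₜ[R] y = x ⊗ₜ[R] b) :
    f a • y = f x • b := by
  simpa using congrArg (fun t => TensorProduct.lid R V (f.rTensor V t)) h

theorem apply_smul_eq_of_tmul_eq_tmul_right {R U V : Type*} [CommSemiring R]
    [AddCommMonoid U] [Module R U] [AddCommMonoid V] [Module R V]
    (g : Module.Dual R V) {a x : U} {y b : V} (h : a ⊗ₜ[R] y = x ⊗ₜ[R] b) :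
    g y • a = g b • x := by
  simpa using congrArg (fun t => TensorProduct.rid R U (g.lTensor U t)) h

theorem mem_span_pair_of_tmul_eq_tmul {K U V : Type*} [Field K]
    [AddCommGroup U] [Module K U] [AddCommGroup V] [Module K V]
    {a x : U} {y b : V} (ha : a ≠ 0) (hb : b ≠ 0) (h : a ⊗ₜ[K] y = x ⊗ₜ[K] b) :
    (x, y) ∈ Submodule.span K ({(a, b)} : Set (U × V)) := by
  obtain ⟨f, hf⟩ := Module.Projective.exists_dual_eq_one K ha
  obtain ⟨g, hg⟩ := Module.Projective.exists_dual_eq_one K hb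
  have hy : y = f x • b := by simpa [hf] using apply_smul_eq_of_tmul_eq_tmul f h
  have hx : g y • a = x := by simpa [hg] using apply_smul_eq_of_tmul_eq_tmul_right g h
  have hgy : g y = f x := by rw [hy]; simp [hg]
  rw [hgy] at hx
  exact Submodule.mem_span_singleton.2 ⟨f x, by rw [Prod.smul_mk, hx, ← hy]⟩

/-- Lemma 9.3: let `μ_U`, `μ_V` be bilinear alternating maps on finite-dimensional complex
vector spaces `U¹`, `V¹`, and let `μ = μ_U × μ_V` be the alternating map on `Z¹ = U¹ × V¹`
with values in `Z² = U² × V² × (U¹ ⊗ V¹)` given by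
`μ((a,b),(x,y)) = (μ_U(a,x), μ_V(b,y), a ⊗ y − x ⊗ b)`. Then a nonzero `(a,b)` is a
resonant element for `μ` (i.e. some `(x,y) ∉ ℂ·(a,b)` satisfies `μ((a,b),(x,y)) = 0`)
if and only if `b = 0` and `a` is resonant for `μ_U`, or `a = 0` and `b` is resonant
for `μ_V`. -/
theorem resonance_of_product
    {U1 V1 U2 V2 : Type*}
    [AddCommGroup U1] [Module ℂ U1] [AddCommGroup V1] [Module ℂ V1]
    [AddCommGroup U2] [Module ℂ U2] [AddCommGroup V2] [Module ℂ V2]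
    [FiniteDimensional ℂ U1] [FiniteDimensional ℂ V1]
    (μU : U1 →ₗ[ℂ] U1 →ₗ[ℂ] U2) (μV : V1 →ₗ[ℂ] V1 →ₗ[ℂ] V2)
    (hU : ∀ a : U1, μU a a = 0) (hV : ∀ b : V1, μV b b = 0)
    (a : U1) (b : V1) (hab : (a, b) ≠ (0 : U1 × V1)) :
    (∃ x : U1, ∃ y : V1,
        μU a x = 0 ∧ μV b y = 0 ∧ a ⊗ₜ[ℂ] y - x ⊗ₜ[ℂ] b = 0 ∧
        (x, y) ∉ Submodule.span ℂ ({(a, b)} : Set (U1 × V1))) ↔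
      ((b = 0 ∧ ∃ x : U1, μU a x = 0 ∧ x ∉ Submodule.span ℂ ({a} : Set U1)) ∨
       (a = 0 ∧ ∃ y : V1, μV b y = 0 ∧ y ∉ Submodule.span ℂ ({b} : Set V1))) := by
  constructor
  · rintro ⟨x, y, hx, hy, h, hxy⟩
    rw [sub_eq_zero] at h
    by_cases hb : b = 0
    · subst hb
      have ha : a ≠ 0 := fun ha => hab (by simp [ha])
      obtain ⟨f, hf⟩ := Module.Projective.exists_dual_eq_one ℂ ha
      have hy0 : y = 0 := by simpa [hf] using apply_smul_eq_of_tmul_eq_tmul f h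
      subst hy0
      refine Or.inl ⟨rfl, x, hx, fun hxa => hxy ?_⟩
      obtain ⟨c, rfl⟩ := Submodule.mem_span_singleton.1 hxa
      exact Submodule.mem_span_singleton.2 ⟨c, by simp⟩
    · by_cases ha : a = 0
      · subst ha
        obtain ⟨g, hg⟩ := Module.Projective.exists_dual_eq_one ℂ hb
        have hx0 : x = 0 := by
          simpa [hg] using (apply_smul_eq_of_tmul_eq_tmul_right g h).symm
        subst hx0
        refine Or.inr ⟨rfl, y, hy, fun hyb => hxy ?_⟩
        obtain ⟨c, rfl⟩ := Submodule.mem_span_singleton.1 hyb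
        exact Submodule.mem_span_singleton.2 ⟨c, by simp⟩
      · exact absurd (mem_span_pair_of_tmul_eq_tmul ha hb h) hxy
  · rintro (⟨rfl, x, hx, hxa⟩ | ⟨rfl, y, hy, hyb⟩)
    · refine ⟨x, 0, hx, by simp, by simp, fun h => hxa ?_⟩
      obtain ⟨c, hc⟩ := Submodule.mem_span_singleton.1 h
      exact Submodule.mem_span_singleton.2 ⟨c, congrArg Prod.fst hc⟩
    · refine ⟨0, y, by simp, hy, by simp, fun h => hyb ?_⟩
      obtain ⟨c, hc⟩ := Submodule.mem_span_singleton.1 h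
      exact Submodule.mem_span_singleton.2 ⟨c, congrArg Prod.snd hc⟩
end

section
/- Let G₁ and G₂ be groups such that for each i ∈ {1,2} there exists a nonzero group homomorphism φ_i : G_i → (ℂ, +). Let G = G₁ * G₂ be their free product (coproduct of groups). Then for every group homomorphism ρ : G → ℂ*, the first group cohomology H¹(G, ℂ_ρ) is nonzero, where ℂ_ρ denotes the one-dimensional complex representation of G in which g ∈ G acts on ℂ by multiplication by ρ(g). -/
/-- A crossed homomorphism `f` with respect to a representation `ρ` makes the group act on `V` by
the affine maps `x ↦ ρ g x + f g`. -/
def Representation.affineHom {k G V : Type*} [CommRing k] [Group G] [AddCommGroup V] [Module k V]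
    (ρ : Representation k G V) (f : G → V) (hf : ∀ g h, f (g * h) = ρ g (f h) + f g) :
    G →* (V →ᵃ[k] V) where
  toFun g :=
    { toFun := fun x => ρ g x + f g
      linear := ρ g
      map_vadd' := fun p v => by simp [add_assoc] }
  map_one' := by
    ext x
    simpa using hf 1 1
  map_mul' g h := by
    ext x
    simp [hf, add_assoc]

/-- Crossed homomorphisms on the factors extend to the free product. -/
theorem Representation.exists_crossedHom_coprod {k G H V : Type*} [CommRing k] [Group G] [Group H]
    [AddCommGroup V] [Module k V] (ρ : Representation k (Monoid.Coprod G H) V)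
    (f₁ : G → V) (hf₁ : ∀ g h, f₁ (g * h) = ρ (.inl g) (f₁ h) + f₁ g)
    (f₂ : H → V) (hf₂ : ∀ g h, f₂ (g * h) = ρ (.inr g) (f₂ h) + f₂ g) :
    ∃ F : Monoid.Coprod G H → V, (∀ g h, F (g * h) = ρ g (F h) + F g) ∧
      (∀ g, F (.inl g) = f₁ g) ∧ ∀ h, F (.inr h) = f₂ h := by
  let Φ : Monoid.Coprod G H →* (V →ᵃ[k] V) := Monoid.Coprod.lift
    (affineHom (ρ.comp Monoid.Coprod.inl) f₁ hf₁) (affineHom (ρ.comp Monoid.Coprod.inr) f₂ hf₂)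
  have hΦ : AffineMap.linearHom.comp Φ = ρ := by
    apply Monoid.Coprod.hom_ext <;> ext1 g <;>
      simp only [Φ, MonoidHom.comp_apply, Monoid.Coprod.lift_apply_inl,
        Monoid.Coprod.lift_apply_inr] <;> rfl
  refine ⟨fun g => Φ g 0, fun g h => ?_, fun g => ?_, fun h => ?_⟩
  · have hg : (Φ g).linear = ρ g := DFunLike.congr_fun hΦ g
    beta_reduce
    rw [map_mul, AffineMap.coe_mul, Function.comp_apply, ← hg]
    simpa using (Φ g).map_vadd 0 (Φ h 0)
  · simp [Φ, affineHom]
  · simp [Φ, affineHom]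

theorem groupCohomology.nontrivial_H1_of_notMem_coboundaries₁ {k G : Type} [CommRing k] [Group G]
    (A : Rep k G) (F : G → A) (hF : ∀ g h, F (g * h) = A.ρ g (F h) + F g)
    (hF' : F ∉ coboundaries₁ A) : Nontrivial (groupCohomology A 1) :=
  ⟨H1π A ⟨F, (mem_cocycles₁_iff F).2 hF⟩, 0, fun h => hF' ((H1π_eq_zero_iff _).1 h)⟩

/-- Lemma 9.6: let `G₁` and `G₂` be groups, each admitting a nonzero homomorphism to the
additive group `ℂ` (i.e. having positive first Betti number), and let `G = G₁ * G₂` be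
their free product. Then for every character `ρ : G → ℂ*`, the first group cohomology
`H¹(G, ℂ_ρ)` of `G` with coefficients in the one-dimensional representation determined
by `ρ` is nonzero. -/
theorem free_product_first_characteristic_variety_is_everything
    {G1 G2 : Type} [Group G1] [Group G2]
    (φ1 : G1 →* Multiplicative ℂ) (hφ1 : φ1 ≠ 1)
    (φ2 : G2 →* Multiplicative ℂ) (hφ2 : φ2 ≠ 1)
    (ρ : Monoid.Coprod G1 G2 →* ℂˣ) :
    Nontrivial (groupCohomology
      (Rep.of ((((Algebra.lmul ℂ ℂ).toRingHom.toMonoidHom).comp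
        ((Units.coeHom ℂ).comp ρ) :
          Representation ℂ (Monoid.Coprod G1 G2) ℂ))) 1) := by
  set σ : Representation ℂ (Monoid.Coprod G1 G2) ℂ :=
    ((Algebra.lmul ℂ ℂ).toRingHom.toMonoidHom).comp ((Units.coeHom ℂ).comp ρ)
  have hσ (g) (z : ℂ) : σ g z = ρ g * z := rfl
  suffices H : ∃ f₁ : G1 → ℂ, ∃ f₂ : G2 → ℂ,
      (∀ g h, f₁ (g * h) = ρ (.inl g) * f₁ h + f₁ g) ∧
      (∀ g h, f₂ (g * h) = ρ (.inr g) * f₂ h + f₂ g) ∧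
      ¬ ∃ c : ℂ, (∀ g, ρ (.inl g) * c - c = f₁ g) ∧ ∀ h, ρ (.inr h) * c - c = f₂ h by
    obtain ⟨f₁, f₂, hf₁, hf₂, hf⟩ := H
    obtain ⟨F, hF, hF₁, hF₂⟩ := σ.exists_crossedHom_coprod f₁ hf₁ f₂ hf₂
    refine groupCohomology.nontrivial_H1_of_notMem_coboundaries₁ (Rep.of σ) F hF ?_
    rintro ⟨c, hc⟩
    exact hf ⟨c, fun g => (congr_fun hc _).trans (hF₁ g), fun h => (congr_fun hc _).trans (hF₂ h)⟩
  by_cases h₂ : ∀ h : G2, ρ (.inr h) = 1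
  · refine ⟨0, fun h => (φ2 h).toAdd, by simp, fun g h => by simp [h₂, add_comm], ?_⟩
    rintro ⟨c, -, hc⟩
    refine hφ2 (MonoidHom.ext fun h => ?_)
    have h0 : (φ2 h).toAdd = 0 := by simpa [h₂, eq_comm] using hc h
    exact h0
  push Not at h₂
  obtain ⟨h₀, hh₀⟩ := h₂
  obtain ⟨f₁, hf₁, g₀, hg₀⟩ : ∃ f₁ : G1 → ℂ,
      (∀ g h, f₁ (g * h) = ρ (.inl g) * f₁ h + f₁ g) ∧ ∃ g, f₁ g ≠ 0 := by
    by_cases h₁ : ∀ g : G1, ρ (.inl g) = 1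
    · refine ⟨fun g => (φ1 g).toAdd, fun g h => by simp [h₁, add_comm], ?_⟩
      by_contra! h
      exact hφ1 (MonoidHom.ext h)
    · push Not at h₁
      obtain ⟨g, hg⟩ := h₁
      refine ⟨fun g => ρ (.inl g) - 1, fun g h => by simp; ring, g, ?_⟩
      simpa [sub_eq_zero] using hg
  refine ⟨f₁, 0, hf₁, by simp, ?_⟩
  rintro ⟨c, hc₁, hc₂⟩
  have hc : c = 0 := by
    have h : ((ρ (.inr h₀) : ℂ) - 1) * c = 0 := by simpa [sub_mul] using hc₂ h₀
    refine (mul_eq_zero.1 h).resolve_left fun h' => hh₀ ?_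
    simpa [sub_eq_zero] using h'
  exact hg₀ (by simp [← hc₁, hc])
end

section
/- Let V be a finite vertex set and Γ a simple graph on V. Suppose that for every subset W ⊆ V that is maximal among subsets inducing a disconnected subgraph — that is, the induced subgraph Γ(W) is not preconnected, but Γ(W') is preconnected for every W' strictly containing W — the induced subgraph Γ(W) has no edges. Then Γ is a complete multipartite graph; equivalently, non-adjacency is transitive on distinct vertices: there are no three vertices u, v, w with u adjacent to v, w not adjacent to u, and w not adjacent to v, so the vertex set partitions into independent sets with every pair of vertices in distinct blocks adjacent. -/
/-- The combinatorial core of Theorem 11.1 (ii) ⇒ (iii): let `Γ` be a simple graph on a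
finite vertex set `V`. Suppose that every subset `W ⊆ V` that is maximal among subsets
inducing a disconnected (non-preconnected) subgraph induces a subgraph with no edges.
Then `Γ` is a complete multipartite graph; equivalently, there are no three vertices
`u, v, w` with `u` adjacent to `v`, `w` not adjacent to `u`, and `w` not adjacent to `v`. -/
theorem complete_multipartite_of_maximally_disconnected_discrete
    {V : Type*} [Fintype V] (Γ : SimpleGraph V)
    (h : ∀ W : Set V, ¬ (Γ.induce W).Preconnected →
        (∀ W' : Set V, W ⊂ W' → (Γ.induce W').Preconnected) →
        ∀ u ∈ W, ∀ v ∈ W, ¬ Γ.Adj u v) :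
    ¬ ∃ u v w : V, Γ.Adj u v ∧ ¬ Γ.Adj w u ∧ ¬ Γ.Adj w v := by
  rintro ⟨u, v, w, huv, hwu, hwv⟩
  have hdisc : ¬ (Γ.induce {u, v, w}).Preconnected := by
    intro hc
    have hne : (⟨w, by simp⟩ : ({u, v, w} : Set V)) ≠ ⟨u, by simp⟩ := by
      rintro heq
      obtain rfl := Subtype.mk.inj heq
      exact hwv huv
    obtain ⟨p⟩ := hc ⟨w, by simp⟩ ⟨u, by simp⟩
    cases p with
    | nil => exact hne rfl
    | @cons _ x _ hadj _ =>
      obtain ⟨x, rfl | rfl | rfl⟩ := x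
      · exact hwu hadj
      · exact hwv hadj
      · exact Γ.irrefl hadj
  obtain ⟨W, hle, hmax⟩ :=
    (Set.toFinite {W : Set V | ¬ (Γ.induce W).Preconnected}).exists_le_maximal hdisc
  refine h W hmax.prop (fun W' hW' => ?_) u (hle (by simp)) v (hle (by simp)) huv
  by_contra hc
  exact hmax.not_prop_of_gt hW' hc
end
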